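/- In ℂ[x,y], define f2 = 1 + (33863/1650)x + y - (33863/1650)x^2 + (23404966/226875)xy - (12222527/907500)y^2, g2 = 2 + (13727/550)x + 7y - (14277/550)x^2 + (43781281/302500)xy - (1217817/75625)y^2, and h2 = -1/4 - (2517/275)x + y + (9243/1100)x^2 - (1667401/151250)xy + (209923/151250)y^2. Let g = f2^3 + g2^2 * h2. Then g is irreducible in ℂ[x,y], and there do not exist polynomials p, q ∈ ℂ[x,y] with total degree of p at most 2 and total degree of q at most 3 such that g = p^3 + q^2. -/

import Mathlib

open MvPolynomial

noncomputable section

def x : MvPolynomial (Fin 2) ℂ := X 0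
def y : MvPolynomial (Fin 2) ℂ := X 1
def c (q : ℚ) : MvPolynomial (Fin 2) ℂ := C (q : ℂ)

def f2 : MvPolynomial (Fin 2) ℂ :=
  1 + c (33863/1650) * x + y - c (33863/1650) * x ^ 2 + c (23404966/226875) * x * y
    - c (12222527/907500) * y ^ 2

def g2 : MvPolynomial (Fin 2) ℂ :=
  2 + c (13727/550) * x + 7 * y - c (14277/550) * x ^ 2 + c (43781281/302500) * x * y
    - c (1217817/75625) * y ^ 2

def h2 : MvPolynomial (Fin 2) ℂ :=
  - c (1/4) - c (2517/275) * x + y + c (9243/1100) * x ^ 2 - c (1667401/151250) * x * y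
    + c (209923/151250) * y ^ 2

/-- The sextic of semi-torus type with configuration `[A_5 + 4A_2]`. -/
def g : MvPolynomial (Fin 2) ℂ := f2 ^ 3 + g2 ^ 2 * h2

def Gtab : List (List ℤ) := [
  [0, 0, 0, 0, 5743292075451562500, 14666680519889062500, -62277371603414144375],
  [0, 0, -11486584150903125000, -112882434844026375000, -626778132015461250, 1399435578404610562200, 0],
  [5743292075451562500, 98215754324137312500, 292753868825666015625, -2358914182144907174700, -10683869352349551220956, 0, 0],
  [75600075855474500000, 1643857819652334247500, 12033590928628630670100, 29274973008769601944282, 0, 0, 0],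
  [-257583376238087625000, -3529485339251160052500, -12121192100002079985825, 0, 0, 0, 0],
  [265393356607945500000, 1787381870182813492500, 0, 0, 0, 0, 0],
  [-89153348300783937500, 0, 0, 0, 0, 0, 0]]

def colL : List (ℕ × ℕ) := [
  (0, 0),
  (0, 1),
  (1, 0),
  (0, 2),
  (1, 1),
  (2, 0),
  (0, 3),
  (1, 2),
  (2, 1),
  (3, 0),
  (0, 4),
  (1, 3),
  (2, 2),
  (3, 1),
  (4, 0),
  (0, 5),
  (1, 4),
  (2, 3),
  (3, 2),
  (4, 1),
  (5, 0)]

def rowL6 : List (ℕ × ℕ × Bool) := [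
  (0, 6, true),
  (1, 5, true),
  (2, 4, true),
  (3, 3, true),
  (4, 2, true),
  (5, 1, true),
  (6, 0, true),
  (0, 2, false),
  (1, 1, false),
  (2, 0, false),
  (2, 1, false),
  (3, 0, false),
  (0, 4, false),
  (1, 3, false),
  (2, 2, false),
  (3, 1, false),
  (4, 0, false),
  (0, 5, false),
  (1, 4, false),
  (2, 3, false),
  (3, 2, false),
  (4, 1, false),
  (5, 0, false),
  (0, 6, false),
  (1, 5, false),
  (2, 4, false),
  (3, 3, false),
  (4, 2, false),
  (5, 1, false),
  (6, 0, false),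
  (0, 7, false),
  (1, 6, false),
  (2, 5, false),
  (3, 4, false),
  (4, 3, false),
  (5, 2, false),
  (6, 1, false),
  (7, 0, false),
  (1, 7, false),
  (2, 6, false),
  (3, 5, false),
  (4, 4, false)]

def LL6 : List ℕ := [
  232810788373450,
  136853045626864745759,
  183188317816503130657902304035209698,
  136213104567435921067981615358599469,
  183188317816502993816725860504404676,
  131802508424972917297138800185201314,
  296553501656083182496441730144716900,
  16925696615055486438415519696630281,
  61467261176536161598121308579324778,
  58206973565127915578468031441033310,
  223433252455719452176896350806801394,
  232769585679484489763518606803984764,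
  5838518565247974014464109494043965,
  138578349473776281907685368288044372,
  271110234622834015297801652875202326,
  275008811334582428804722552661177420,
  308684537188266347251508466202711741,
  203456675976596817599697810098307143,
  306853582737352719732869641499594862,
  129844269958318553427712594663026043,
  117649,
  2470629,
  1163666314177381,
  54741451312981549977,
  54741916104110712365,
  271514005719209395778481576446163404,
  150260635071191723218706653017640256,
  47887416461875128041553894781522141,
  123368553919399104160973900847490667,
  303933922499458464137221249364657481,
  278655472093986468901053218493231980,
  176228236669265593333374046658393076,
  180661564300252408714685060397123005,
  61366985860458187864052056427530623,
  220647443689326404472950987830469597,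
  232134077414267735529976934994615043,
  1,
  88960243599723257303970944692361477,
  55284525477033082023555858373116716,
  160512386666163275283096315198418457,
  57115479927485385288272232972569522,
  234106230591059670590235304278638069]

def ML6 : List ℕ := [
  16370068574555390765,
  19646749668076499586602628,
  13481390486974375481502805,
  14422746630892320589881095046684,
  113259541435943733999424049488016,
  77717479916252008419501843976117,
  135522937027858548574757731038136765,
  159317912818092034087358835779368294,
  270192790109363301805004611733023312,
  31885378067948105940445296537711089,
  60939752848223504932243473839320248,
  50155247908197252461467618542370851,
  170092659825300508505353966115879739,
  191098204923334504389417329160285148,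
  267423808808743156183272408659742756,
  183597908612265051194080001806840840,
  9095625658468457039983159422277446,
  183729485550078824633344706333323363,
  210118227583839460534697417350881984,
  178382691641583326131951448042405570,
  121979618909544059701835075671295,
  4929271836615096740,
  579917460774790996727191,
  8887336793805557030417103,
  477586207699359566635884681954,
  7319089665789404299771392232605,
  63479828427779226345942624483520,
  81339295962471710466943622228527603,
  100051772994628830579270436104181734,
  178796801371693542597341585532261617,
  94717380627547467263252247620441899,
  85627087355015675692741114309311466,
  60939485238651751588608336962411923,
  50155978881650846220905648299528534,
  170098101338517689587006331271215400,
  191006739523099914605648395819562269,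
  38330774222859836595864033004469793,
  48205854806280254313233797009796629,
  4288175688346635864377987176612362,
  143708257086623440966221709129664917,
  241943489442886411830948441464874854,
  89183390639523754250906515994998010]

def rowL5 : List (ℕ × ℕ × Bool) := [
  (0, 6, true),
  (1, 5, true),
  (2, 4, true),
  (3, 3, true),
  (4, 2, true),
  (5, 1, true),
  (6, 0, true),
  (0, 2, false),
  (1, 1, false),
  (2, 0, false),
  (2, 1, false),
  (3, 0, false),
  (0, 4, false),
  (1, 3, false),
  (2, 2, false),
  (3, 1, false),
  (4, 0, false),
  (0, 5, false),
  (1, 4, false),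
  (2, 3, false),
  (3, 2, false),
  (4, 1, false),
  (5, 0, false),
  (0, 6, false),
  (1, 5, false),
  (2, 4, false),
  (3, 3, false),
  (4, 2, false),
  (5, 1, false),
  (6, 0, false),
  (1, 6, false),
  (2, 5, false),
  (3, 4, false),
  (4, 3, false),
  (5, 2, false),
  (6, 1, false),
  (7, 0, false),
  (0, 8, false),
  (1, 7, false),
  (2, 6, false),
  (3, 5, false),
  (4, 4, false)]

def LL5 : List ℕ := [
  930952434579370,
  27371540250868831045,
  310528646739051029905101252681616287,
  208939938639924885669664216310011541,
  46188203165751557324591246163204359,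
  175806870303416692484288466760657089,
  110991295771583017145554064632135023,
  231949072917427588490336431205857543,
  275560209055289161482519372836887797,
  98549174018837751108607594125868763,
  45142249955624652305858178943422701,
  156792602843802544887970752441599585,
  79456675727795098687152713134212298,
  193165940013394571876536844217720252,
  2103802571425432481782450934796574,
  141317956002517556032784259484404339,
  81586403296319766550160862578165848,
  128905274098332996073306105308193199,
  137155224884616099813953623951672283,
  71886852165451777415615694799966456,
  117649,
  4117715,
  1396380200363736,
  54740985790481143692,
  82112292621481551632,
  2320084603804636746823597432968875,
  128654240347800038433375345500621446,
  56998230235558842935299780791962536,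
  212759339551631895038408251846910510,
  95472181519179101541282775500275435,
  93857450919735687860338576428323179,
  117640901846496196311597228144107951,
  46642585289402688414649540550924732,
  153531480159235835348589985497699862,
  59969318605234691481422372062101418,
  35980411534296952349316164600176169,
  1,
  222650727844089415916474737804162529,
  282382605252022287613722568950160693,
  234933853755519121951679330641317545,
  182246197454254425108378171252577817,
  291172666816488501392297969934799510]

def ML5 : List ℕ := [
  5369728063312219131,
  21497370519484278278414772,
  4422095693378888831186874,
  1908138284194193005488579347526,
  17704009009608967519817468444130,
  3641785953593719043973313623702,
  193807206207491406393660379143080457,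
  255454156643676325541956437113282976,
  918480882932530656343074550241336,
  19112429040665575597664818021142859,
  139605720250505679487957498815788671,
  281958599104726524400158624989634433,
  232844367324251781532837796281380639,
  6380219057486352240140585388731901,
  222840304478667255241471433757683575,
  182502726530329691930657827934854142,
  1299373516345287732697177496088758,
  167356263551764807001740819086357489,
  95504011431991600012897517146823361,
  18508002184885378003963930864772,
  13637472921563932140577834651597,
  9220172295789200620,
  1084734520269300967828839,
  12477381092293013918913031,
  127617931572741271074968369724,
  1467944968315288948000498890250,
  11978723564337485336673492854206,
  111743959820430065520965550032207208,
  39147833512724358102270081449473145,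
  108756713923103054395848123439768583,
  228297179690835560354848132042811991,
  126723570960006221070136356950501928,
  36585931336844326103328868726257612,
  184767411329061298415574496791385551,
  221020665521036857851044112649252977,
  235587734599348314060990273099315860,
  32205271370899000937296600201697489,
  5048898325398999461966255308313608,
  7016505219999925657177456398209216,
  207376185477347272473102771401200695,
  63669982626526487011100861528749754,
  89153788671010805957449954514188821]

def Gc (i j : ℕ) : ℤ := (Gtab.getD i []).getD j 0

def dig (u k : ℕ) : ℕ := u / 7 ^ k % 7

def dot : ℕ → ℕ → ℕ → ℕ
  | 0, _, _ => 0
  | n + 1, u, w => (u % 7) * (w % 7) + dot n (u / 7) (w / 7)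

theorem dot_eq (n u w : ℕ) : dot n u w = ∑ k : Fin n, dig u k * dig w k := by
  induction n generalizing u w with
  | zero => simp [dot]
  | succ n ih =>
    rw [Fin.sum_univ_succ, dot, ih]
    simp [dig, pow_succ', Nat.div_div_eq_div_mul]

/-- matrix entry: row `r`, column `(k,l)` of the `a`-block -/
def entA (t : ℤ) (r : ℕ × ℕ × Bool) (q : ℕ × ℕ) : ℤ :=
  if r.2.2 then (if q.1 + 1 = r.1 ∧ q.2 = r.2.1 then 1 else 0)
  else if q.1 ≤ r.1 ∧ q.2 ≤ r.2.1 + 1 then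
    Gc (r.1 - q.1) (r.2.1 + 1 - q.2) * (-6 * (q.2 : ℤ) + t * ((r.2.1 + 1 - q.2 : ℕ) : ℤ)) else 0

def entB (t : ℤ) (r : ℕ × ℕ × Bool) (q : ℕ × ℕ) : ℤ :=
  if r.2.2 then (if q.1 = r.1 ∧ q.2 + 1 = r.2.1 then 1 else 0)
  else if q.1 ≤ r.1 + 1 ∧ q.2 ≤ r.2.1 then
    Gc (r.1 + 1 - q.1) (r.2.1 - q.2) * (6 * (q.1 : ℤ) - t * ((r.1 + 1 - q.1 : ℕ) : ℤ)) else 0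

def colq (j : ℕ) : ℕ × ℕ := colL.getD j (0, 0)

def ent (t : ℤ) (r : ℕ × ℕ × Bool) (j : ℕ) : ℤ :=
  if j < 21 then entA t r (colq j) else entB t r (colq (j - 21))

def chk1 (LL ML : List ℕ) : Bool :=
  (List.range 42).all fun i => (List.range 42).all fun j =>
    dot 42 (LL.getD i 0) (ML.getD j 0) % 7 == if i = j then 1 else 0

def chk2 (t : ℤ) (rowL : List (ℕ × ℕ × Bool)) (ML : List ℕ) : Bool :=
  (List.range 42).all fun k => (List.range 42).all fun j =>
    (ent t (rowL.getD k (0, 0, true)) j) % 7 == (dig (ML.getD j 0) k : ℤ)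

theorem chk1_6 : chk1 LL6 ML6 = true := by decide +kernel
theorem chk2_6 : chk2 6 rowL6 ML6 = true := by decide +kernel
theorem chk1_5 : chk1 LL5 ML5 = true := by decide +kernel
theorem chk2_5 : chk2 5 rowL5 ML5 = true := by decide +kernel

theorem det_ne (t : ℤ) (rowL : List (ℕ × ℕ × Bool)) (LL ML : List ℕ)
    (h1 : chk1 LL ML = true) (h2 : chk2 t rowL ML = true) :
    (Matrix.of fun k j : Fin 42 => ent t (rowL.getD k (0, 0, true)) j).det ≠ 0 := by
  intro h0
  set M : Matrix (Fin 42) (Fin 42) ℤ :=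
    Matrix.of fun k j : Fin 42 => ent t (rowL.getD k (0, 0, true)) j with hM
  let L : Matrix (Fin 42) (Fin 42) (ZMod 7) :=
    Matrix.of fun i k : Fin 42 => (dig (LL.getD i 0) k : ZMod 7)
  have hM' : ∀ k j, ((M k j : ℤ) : ZMod 7) = (dig (ML.getD j 0) k : ZMod 7) := by
    intro k j
    simp only [chk2, List.all_eq_true, List.mem_range, beq_iff_eq] at h2
    have h := h2 k k.2 j j.2
    have h' : ((M k j % 7 : ℤ) : ZMod 7) = ((dig (ML.getD j 0) k : ℤ) : ZMod 7) := by
      rw [← h]; rfl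
    have h7 : ((M k j % (7 : ℕ) : ℤ) : ZMod 7) = ((M k j : ℤ) : ZMod 7) := ZMod.intCast_mod _ 7
    rw [← h7]
    exact_mod_cast h'
  have hL : L * M.map (Int.castRingHom (ZMod 7)) = 1 := by
    ext i j
    simp only [chk1, List.all_eq_true, List.mem_range, beq_iff_eq] at h1
    have h := h1 i i.2 j j.2
    rw [Matrix.mul_apply]
    have e : ∑ k, L i k * (M.map (Int.castRingHom (ZMod 7))) k j
        = ((dot 42 (LL.getD i 0) (ML.getD j 0) : ℕ) : ZMod 7) := by
      rw [dot_eq]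
      push_cast
      refine Finset.sum_congr rfl fun k _ => ?_
      rw [Matrix.map_apply, ← hM']
      rfl
    rw [e, ← ZMod.natCast_mod, h, Matrix.one_apply]
    simp only [Fin.ext_iff]
    split_ifs <;> simp
  have hd := congrArg Matrix.det hL
  rw [Matrix.det_mul, Matrix.det_one, ← RingHom.mapMatrix_apply, ← RingHom.map_det, h0] at hd
  simp only [map_zero, mul_zero] at hd
  exact absurd hd (by decide)
def ee (i j : ℕ) : Fin 2 →₀ ℕ := Finsupp.single 0 i + Finsupp.single 1 j

theorem ee0 (i j : ℕ) : ee i j 0 = i := by simp [ee]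
theorem ee1 (i j : ℕ) : ee i j 1 = j := by simp [ee]
theorem ee_eta (m : Fin 2 →₀ ℕ) : m = ee (m 0) (m 1) := by
  ext i; fin_cases i <;> simp [ee]
theorem ee_inj {i j k l : ℕ} : ee i j = ee k l ↔ i = k ∧ j = l := by
  constructor
  · intro h
    have h0 := DFunLike.congr_fun h 0
    have h1 := DFunLike.congr_fun h 1
    rw [ee0, ee0] at h0
    rw [ee1, ee1] at h1
    exact ⟨h0, h1⟩
  · rintro ⟨rfl, rfl⟩; rfl
theorem ee_le {i j k l : ℕ} : ee i j ≤ ee k l ↔ i ≤ k ∧ j ≤ l := by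
  rw [Finsupp.le_def, Fin.forall_fin_two, ee0, ee0, ee1, ee1]
theorem ee_sub (i j k l : ℕ) : ee i j - ee k l = ee (i - k) (j - l) := by
  rw [ee_eta (ee i j - ee k l)]; simp [ee0, ee1]
theorem ee_add0 (i j : ℕ) : ee i j + Finsupp.single 0 1 = ee (i + 1) j := by
  rw [ee_eta (ee i j + Finsupp.single 0 1)]; simp [ee0, ee1]
theorem ee_add1 (i j : ℕ) : ee i j + Finsupp.single 1 1 = ee i (j + 1) := by
  rw [ee_eta (ee i j + Finsupp.single 1 1)]; simp [ee0, ee1]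
theorem ee_deg (m : Fin 2 →₀ ℕ) : m.degree = m 0 + m 1 := by
  simp [Finsupp.degree_eq_sum]
theorem coeff_deg {a : MvPolynomial (Fin 2) ℂ} {d : ℕ} (ha : a.totalDegree ≤ d)
    {i j : ℕ} (h : d < i + j) : coeff (ee i j) a = 0 := by
  apply coeff_eq_zero_of_totalDegree_lt
  have := ee_deg (ee i j)
  rw [ee0, ee1] at this
  rw [← Finsupp.degree_apply, this]
  omega

abbrev dx (a : MvPolynomial (Fin 2) ℂ) : MvPolynomial (Fin 2) ℂ := pderiv 0 a
abbrev dy (a : MvPolynomial (Fin 2) ℂ) : MvPolynomial (Fin 2) ℂ := pderiv 1 a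

theorem dxy (a : MvPolynomial (Fin 2) ℂ) : dx (dy a) = dy (dx a) := by
  ext m
  rw [ee_eta m]
  simp only [dx, dy, coeff_pderiv, ee_add0, ee_add1, ee0, ee1]
  ring

def gi : MvPolynomial (Fin 2) ℂ :=
  ∑ i ∈ Finset.range 7, ∑ j ∈ Finset.range 7, monomial (ee i j) (Gc i j : ℂ)

theorem Gc_zero {i j : ℕ} (h : ¬ (i < 7 ∧ j < 7)) : Gc i j = 0 := by
  unfold Gc
  by_cases hi : i < 7
  · have hj : 7 ≤ j := by omega
    have : (Gtab.getD i []).length ≤ 7 := by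
      interval_cases i <;> decide
    exact List.getD_eq_default _ _ (by omega)
  · rw [List.getD_eq_default Gtab _ (by simp [Gtab]; omega)]
    simp

theorem coeff_gi (i j : ℕ) : coeff (ee i j) gi = (Gc i j : ℂ) := by
  simp only [gi, coeff_sum, coeff_monomial, ee_inj]
  have : ∀ k l : ℕ, (if k = i ∧ l = j then (Gc k l : ℂ) else 0)
      = if k = i then (if l = j then (Gc k l : ℂ) else 0) else 0 := by
    intro k l; rw [ite_and]
  simp only [this]
  by_cases h : i < 7 ∧ j < 7
  · rw [Finset.sum_eq_single i]
    · rw [Finset.sum_eq_single j]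
      · simp
      · intro b _ hb; simp [hb]
      · intro hj; simp at hj; omega
    · intro b _ hb; simp [hb]
    · intro hj; simp at hj; omega
  · rw [Gc_zero h, Int.cast_zero]
    apply Finset.sum_eq_zero
    intro k hk
    apply Finset.sum_eq_zero
    intro l hl
    simp at hk hl
    split_ifs with h1 h2
    · omega
    · rfl
    · rfl

def EE (t : ℤ) (a b : MvPolynomial (Fin 2) ℂ) : MvPolynomial (Fin 2) ℂ :=
  6 * gi * (dx b - dy a) + (t : MvPolynomial (Fin 2) ℂ) * (a * dy gi - b * dx gi)

theorem monoA (t : ℤ) (i j k l : ℕ) (r : ℂ) :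
    coeff (ee i j) (EE t (monomial (ee k l) r) 0) = (entA t (i, j, false) (k, l) : ℂ) * r := by
  have e6 : (6 : MvPolynomial (Fin 2) ℂ) = C 6 := (map_ofNat C 6).symm
  have et : (t : MvPolynomial (Fin 2) ℂ) = C (t : ℂ) := (map_intCast (C : ℂ →+* MvPolynomial (Fin 2) ℂ) t).symm
  have h1 : EE t (monomial (ee k l) r) 0
    = C (-6) * (monomial (ee k l - Finsupp.single 1 1) (r * l) * gi)
      + C (t : ℂ) * (monomial (ee k l) r * dy gi) := by
    simp only [EE, dx, dy, map_zero, pderiv_monomial, ee1, et, e6, map_neg]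
    ring
  have h2 : ee k l - Finsupp.single 1 1 = ee k (l - 1) := by
    have : (Finsupp.single 1 1 : Fin 2 →₀ ℕ) = ee 0 1 := by simp [ee]
    rw [this, ee_sub]; simp
  rw [h1, h2, coeff_add, coeff_C_mul, coeff_C_mul, coeff_monomial_mul', coeff_monomial_mul']
  simp only [ee_le, ee_sub, dy, coeff_pderiv, ee_add1, ee1, coeff_gi, entA]
  by_cases hk : k ≤ i
  · rcases Nat.lt_trichotomy l (j + 1) with h | h | h
    · have a1 : l ≤ j := by omega
      have a2 : l - 1 ≤ j := by omega
      have a3 : l ≤ j + 1 := by omega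
      have a4 : j - l + 1 = j + 1 - l := by omega
      simp only [hk, a1, a2, a3, a4, and_self, if_true]
      rcases l with _ | l
      · push_cast; simp; ring
      · have a5 : j - (l + 1 - 1) = j + 1 - (l + 1) := by omega
        have a6 : ((j - (l + 1) : ℕ) : ℂ) + 1 = ((j + 1 - (l + 1) : ℕ) : ℂ) := by
          rw [← a4]; push_cast; ring
        rw [a5, a6]
        push_cast; simp; ring
    · subst h
      simp [hk]; ring
    · have a1 : ¬ l ≤ j := by omega
      have a2 : ¬ l - 1 ≤ j := by omega
      have a3 : ¬ l ≤ j + 1 := by omega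
      simp [a1, a2, a3]
  · simp [hk]

theorem monoB (t : ℤ) (i j k l : ℕ) (r : ℂ) :
    coeff (ee i j) (EE t 0 (monomial (ee k l) r)) = (entB t (i, j, false) (k, l) : ℂ) * r := by
  have e6 : (6 : MvPolynomial (Fin 2) ℂ) = C 6 := (map_ofNat C 6).symm
  have et : (t : MvPolynomial (Fin 2) ℂ) = C (t : ℂ) := (map_intCast (C : ℂ →+* MvPolynomial (Fin 2) ℂ) t).symm
  have h1 : EE t 0 (monomial (ee k l) r)
    = C (6) * (monomial (ee k l - Finsupp.single 0 1) (r * k) * gi)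
      - C (t : ℂ) * (monomial (ee k l) r * dx gi) := by
    simp only [EE, dx, dy, map_zero, pderiv_monomial, ee0, et, e6]
    ring
  have h2 : ee k l - Finsupp.single 0 1 = ee (k - 1) l := by
    have : (Finsupp.single 0 1 : Fin 2 →₀ ℕ) = ee 1 0 := by simp [ee]
    rw [this, ee_sub]; simp
  rw [h1, h2, coeff_sub, coeff_C_mul, coeff_C_mul, coeff_monomial_mul', coeff_monomial_mul']
  simp only [ee_le, ee_sub, dx, coeff_pderiv, ee_add0, ee0, coeff_gi, entB]
  by_cases hk : l ≤ j
  · rcases Nat.lt_trichotomy k (i + 1) with h | h | h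
    · have a1 : k ≤ i := by omega
      have a2 : k - 1 ≤ i := by omega
      have a3 : k ≤ i + 1 := by omega
      have a4 : i - k + 1 = i + 1 - k := by omega
      simp only [hk, a1, a2, a3, a4, and_self, if_true]
      rcases k with _ | k
      · push_cast; simp; ring
      · have a5 : i - (k + 1 - 1) = i + 1 - (k + 1) := by omega
        have a6 : ((i - (k + 1) : ℕ) : ℂ) + 1 = ((i + 1 - (k + 1) : ℕ) : ℂ) := by
          rw [← a4]; push_cast; ring
        rw [a5, a6]
        push_cast; ring
    · subst h
      simp [hk]; ring
    · have a1 : ¬ k ≤ i := by omega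
      have a2 : ¬ k - 1 ≤ i := by omega
      have a3 : ¬ k ≤ i + 1 := by omega
      simp [a1, a2, a3]
  · simp [hk]

theorem expand {a : MvPolynomial (Fin 2) ℂ} (ha : a.totalDegree ≤ 5) :
    a = ∑ s : Fin 21, monomial (ee (colq s).1 (colq s).2) (coeff (ee (colq s).1 (colq s).2) a) := by
  ext m
  rw [ee_eta m]
  generalize m 0 = i
  generalize m 1 = j
  simp only [coeff_sum, coeff_monomial, ee_inj]
  by_cases h : 5 < i + j
  · rw [coeff_deg ha h, Finset.sum_eq_zero]
    intro s _
    have : (colq s).1 + (colq s).2 ≤ 5 := by revert s; decide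
    rw [if_neg (by omega)]
  · have hex : ∀ i < 6, ∀ j < 6, ¬ 5 < i + j → ∃ s : Fin 21, colq s = (i, j) := by decide
    have hinj : ∀ s u : Fin 21, colq s = colq u → s = u := by decide
    obtain ⟨s, hs⟩ := hex i (by omega) j (by omega) h
    rw [Finset.sum_eq_single s]
    · simp [hs]
    · intro u _ hu
      rw [if_neg]
      rintro ⟨h1, h2⟩
      exact hu (hinj _ _ (by rw [hs]; exact Prod.ext h1 h2))
    · simp

theorem EE_add (t : ℤ) (a b a' b' : MvPolynomial (Fin 2) ℂ) :
    EE t (a + a') (b + b') = EE t a b + EE t a' b' := by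
  simp only [EE, dx, dy, map_add]; ring

def EEhom (t : ℤ) (m : Fin 2 →₀ ℕ) :
    MvPolynomial (Fin 2) ℂ × MvPolynomial (Fin 2) ℂ →+ ℂ :=
  AddMonoidHom.mk' (fun q => coeff m (EE t q.1 q.2)) (by
    intro p q; simp [EE_add])

def TThom (m : Fin 2 →₀ ℕ) :
    MvPolynomial (Fin 2) ℂ × MvPolynomial (Fin 2) ℂ →+ ℂ :=
  AddMonoidHom.mk' (fun q => coeff m (X 0 * q.1 + X 1 * q.2)) (by
    intro p q; simp [mul_add]; ring)

theorem topA (t : ℤ) (i j k l : ℕ) (r : ℂ) :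
    coeff (ee i j) (X 0 * monomial (ee k l) r) = (entA t (i, j, true) (k, l) : ℂ) * r := by
  have : (X 0 : MvPolynomial (Fin 2) ℂ) * monomial (ee k l) r = monomial (ee (k+1) l) r := by
    rw [X, monomial_mul, add_comm, ee_add0, one_mul]
  rw [this, coeff_monomial]
  simp [ee_inj, entA]

theorem topB (t : ℤ) (i j k l : ℕ) (r : ℂ) :
    coeff (ee i j) (X 1 * monomial (ee k l) r) = (entB t (i, j, true) (k, l) : ℂ) * r := by
  have : (X 1 : MvPolynomial (Fin 2) ℂ) * monomial (ee k l) r = monomial (ee k (l+1)) r := by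
    rw [X, monomial_mul, add_comm, ee_add1, one_mul]
  rw [this, coeff_monomial]
  simp [ee_inj, entB]

/-- the linear functional attached to a row -/
def rowhom (t : ℤ) (r : ℕ × ℕ × Bool) :
    MvPolynomial (Fin 2) ℂ × MvPolynomial (Fin 2) ℂ →+ ℂ :=
  if r.2.2 then TThom (ee r.1 r.2.1) else EEhom t (ee r.1 r.2.1)

theorem rowA (t : ℤ) (r : ℕ × ℕ × Bool) (q : ℕ × ℕ) (z : ℂ) :
    rowhom t r (monomial (ee q.1 q.2) z, 0) = (entA t r q : ℂ) * z := by
  obtain ⟨i, j, _ | _⟩ := r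
  · exact monoA t i j q.1 q.2 z
  · simpa [rowhom, TThom] using topA t i j q.1 q.2 z

theorem rowB (t : ℤ) (r : ℕ × ℕ × Bool) (q : ℕ × ℕ) (z : ℂ) :
    rowhom t r (0, monomial (ee q.1 q.2) z) = (entB t r q : ℂ) * z := by
  obtain ⟨i, j, _ | _⟩ := r
  · exact monoB t i j q.1 q.2 z
  · simpa [rowhom, TThom] using topB t i j q.1 q.2 z

theorem lin (t : ℤ) (rowL : List (ℕ × ℕ × Bool)) (LL ML : List ℕ)
    (h1 : chk1 LL ML = true) (h2 : chk2 t rowL ML = true)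
    (h3 : ∀ k : Fin 42, (rowL.getD k (0, 0, true)).2.2 = true →
      (rowL.getD k (0, 0, true)).1 + (rowL.getD k (0, 0, true)).2.1 = 6)
    {a b : MvPolynomial (Fin 2) ℂ} (ha : a.totalDegree ≤ 5) (hb : b.totalDegree ≤ 5)
    (hE : EE t a b = 0)
    (hT : ∀ i j, i + j = 6 → coeff (ee i j) (X 0 * a + X 1 * b) = 0) :
    a = 0 ∧ b = 0 := by
  have hd := det_ne t rowL LL ML h1 h2
  set M : Matrix (Fin 42) (Fin 42) ℤ :=
    Matrix.of fun k j : Fin 42 => ent t (rowL.getD k (0, 0, true)) j with hM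
  have hd' : (M.map (Int.castRingHom ℂ)).det ≠ 0 := by
    rw [← RingHom.mapMatrix_apply, ← RingHom.map_det]
    simpa using hd
  let v : Fin 42 → ℂ := fun j => if (j : ℕ) < 21 then
    coeff (ee (colq j).1 (colq j).2) a else coeff (ee (colq (j - 21)).1 (colq (j - 21)).2) b
  have hv : (M.map (Int.castRingHom ℂ)).mulVec v = 0 := by
    ext k
    have h0 : rowhom t (rowL.getD k (0, 0, true)) (a, b) = 0 := by
      by_cases hr : (rowL.getD k (0, 0, true)).2.2 = true
      · simp only [rowhom, hr, if_true]
        exact hT _ _ (h3 k hr)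
      · simp only [rowhom, hr]
        simp [EEhom, hE]
    have hab : (a, b) = (∑ s : Fin 21, (monomial (ee (colq s).1 (colq s).2)
          (coeff (ee (colq s).1 (colq s).2) a), (0 : MvPolynomial (Fin 2) ℂ)))
        + ∑ s : Fin 21, ((0 : MvPolynomial (Fin 2) ℂ), monomial (ee (colq s).1 (colq s).2)
          (coeff (ee (colq s).1 (colq s).2) b)) := by
      ext1
      · simpa [Prod.fst_sum] using expand ha
      · simpa [Prod.snd_sum] using expand hb
    rw [hab, map_add, map_sum, map_sum] at h0
    simp only [rowA, rowB] at h0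
    rw [Pi.zero_apply, ← h0]
    simp only [Matrix.mulVec, dotProduct]
    exact Fin.sum_univ_add (a := 21) (b := 21) _
  have hz := Matrix.eq_zero_of_mulVec_eq_zero hd' hv
  constructor
  · rw [expand ha]
    refine Finset.sum_eq_zero fun s _ => ?_
    have := congrFun hz ⟨s, by omega⟩
    simp only [v, s.2, if_true] at this
    rw [this]; simp
  · rw [expand hb]
    refine Finset.sum_eq_zero fun s _ => ?_
    have := congrFun hz ⟨21 + s, by omega⟩
    simp [v] at this
    rw [this]; simp
theorem mono_eq (i j : ℕ) (r : ℤ) :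
    monomial (ee i j) (r : ℂ) = (r : MvPolynomial (Fin 2) ℂ) * x ^ i * y ^ j := by
  rw [x, y, ee, ← map_intCast (C : ℂ →+* MvPolynomial (Fin 2) ℂ) r, X_pow_eq_monomial, X_pow_eq_monomial, C_apply,
    monomial_mul, monomial_mul]
  simp

theorem gi_eq : gi = C (29895091875000000 : ℂ) * g := by
  have hu : (C (1 / 907500 : ℂ) : MvPolynomial (Fin 2) ℂ) * 907500 = 1 := by
    rw [← map_ofNat (C : ℂ →+* MvPolynomial (Fin 2) ℂ) 907500, ← C_mul]; norm_num
  have hc : ∀ (q : ℚ) (n : ℤ), q = n / 907500 →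
      c q = C (1 / 907500 : ℂ) * (n : MvPolynomial (Fin 2) ℂ) := by
    intro q n h
    rw [c, ← map_intCast (C : ℂ →+* MvPolynomial (Fin 2) ℂ) n, ← C_mul, h]
    congr 1; push_cast; ring
  have h25 : (25 : MvPolynomial (Fin 2) ℂ) * gi = 907500 ^ 3 * g := by
    have hgi : gi = ∑ i ∈ Finset.range 7, ∑ j ∈ Finset.range 7,
        (Gc i j : MvPolynomial (Fin 2) ℂ) * x ^ i * y ^ j := by
      simp only [gi, mono_eq]
    rw [hgi]
    simp only [Finset.sum_range_succ, Finset.sum_range_zero, Gc, Gtab, List.getD_cons_zero,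
      List.getD_cons_succ, g]
    have hf : f2 * 907500 = 907500 + 18624650 * x + 907500 * y - 18624650 * x ^ 2
        + 93619864 * x * y - 12222527 * y ^ 2 := by
      rw [f2, hc (33863/1650) 18624650 (by norm_num), hc (23404966/226875) 93619864 (by norm_num),
        hc (12222527/907500) 12222527 (by norm_num)]
      push_cast
      linear_combination (18624650 * x - 18624650 * x ^ 2 + 93619864 * x * y - 12222527 * y ^ 2) * hu
    have hg : g2 * 907500 = 1815000 + 22649550 * x + 6352500 * y - 23557050 * x ^ 2
        + 131343843 * x * y - 14613804 * y ^ 2 := by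
      rw [g2, hc (13727/550) 22649550 (by norm_num), hc (14277/550) 23557050 (by norm_num),
        hc (43781281/302500) 131343843 (by norm_num), hc (1217817/75625) 14613804 (by norm_num)]
      push_cast
      linear_combination (22649550 * x - 23557050 * x ^ 2 + 131343843 * x * y - 14613804 * y ^ 2) * hu
    have hh : h2 * 907500 = -226875 - 8306100 * x + 907500 * y + 7625475 * x ^ 2
        - 10004406 * x * y + 1259538 * y ^ 2 := by
      rw [h2, hc (1/4) 226875 (by norm_num), hc (2517/275) 8306100 (by norm_num),
        hc (9243/1100) 7625475 (by norm_num), hc (1667401/151250) 10004406 (by norm_num),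
        hc (209923/151250) 1259538 (by norm_num)]
      push_cast
      linear_combination (-226875 - 8306100 * x + 7625475 * x ^ 2
        - 10004406 * x * y + 1259538 * y ^ 2) * hu
    have : (907500 : MvPolynomial (Fin 2) ℂ) ^ 3 * (f2 ^ 3 + g2 ^ 2 * h2)
      = (f2 * 907500) ^ 3 + (g2 * 907500) ^ 2 * (h2 * 907500) := by ring
    rw [this, hf, hg, hh]
    push_cast
    ring
  have h1 : (C (1 / 25 : ℂ) : MvPolynomial (Fin 2) ℂ) * 25 = 1 := by
    rw [← map_ofNat (C : ℂ →+* MvPolynomial (Fin 2) ℂ) 25, ← C_mul]; norm_num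
  have h2 : (C (29895091875000000 : ℂ) : MvPolynomial (Fin 2) ℂ) = 29895091875000000 :=
    map_ofNat C _
  rw [h2]
  linear_combination C (1 / 25 : ℂ) * h25 + (29895091875000000 * g - gi) * h1

theorem eval_g : eval ![1, 0] g = 0 := by
  simp [g, f2, g2, h2, c, x, y]; norm_num

theorem eval_dyg : eval ![1, 0] (dy g) = -1 := by
  have d2 : pderiv 1 (2 : MvPolynomial (Fin 2) ℂ) = 0 := by
    rw [← map_ofNat (C : ℂ →+* MvPolynomial (Fin 2) ℂ) 2, pderiv_C]
  simp [g, f2, g2, h2, c, x, y, dy, pderiv_X, d2]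
  norm_num

theorem EE_of (t : ℤ) (a b : MvPolynomial (Fin 2) ℂ)
    (h : 6 * g * (dx b - dy a) + (t : MvPolynomial (Fin 2) ℂ) * (a * dy g - b * dx g) = 0) :
    EE t a b = 0 := by
  rw [EE, gi_eq]
  simp only [dx, dy, pderiv_C_mul] at *
  linear_combination C (29895091875000000 : ℂ) * h

theorem coeff_euler (i : Fin 2) (A : MvPolynomial (Fin 2) ℂ) (s : Fin 2 →₀ ℕ) :
    coeff s (X i * pderiv i A) = s i * coeff s A := by
  rw [coeff_X_mul']
  split_ifs with h
  · have h' : 1 ≤ s i := Nat.one_le_iff_ne_zero.2 (Finsupp.mem_support_iff.1 h)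
    rw [coeff_pderiv]
    have : s - Finsupp.single i 1 + Finsupp.single i 1 = s :=
      tsub_add_cancel_of_le (by simpa using h')
    rw [this, Finsupp.tsub_apply, Finsupp.single_eq_same, Nat.cast_sub h']
    push_cast; ring
  · rw [Finsupp.notMem_support_iff.1 h]; simp

theorem coeff_ne_deg {A : MvPolynomial (Fin 2) ℂ} {s : Fin 2 →₀ ℕ} (h : coeff s A ≠ 0) {m : ℕ}
    (hA : A.totalDegree ≤ m) : s 0 + s 1 ≤ m := by
  by_contra hc
  apply h
  rw [ee_eta s]
  exact coeff_deg hA (by omega)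

theorem deg_le {A : MvPolynomial (Fin 2) ℂ} {m : ℕ}
    (h : ∀ s, coeff s A ≠ 0 → s 0 + s 1 ≤ m) : A.totalDegree ≤ m := by
  apply Finset.sup_le
  intro s hs
  have := h s (mem_support_iff.1 hs)
  rw [← ee_deg] at this
  exact this

theorem deg_pderiv (i : Fin 2) {A : MvPolynomial (Fin 2) ℂ} {m : ℕ} (hA : A.totalDegree ≤ m + 1) :
    (pderiv i A).totalDegree ≤ m := by
  apply deg_le
  intro s hs
  rw [coeff_pderiv] at hs
  have := coeff_ne_deg (left_ne_zero_of_mul hs) hA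
  fin_cases i <;> simp at this <;> omega

theorem deg_euler {A : MvPolynomial (Fin 2) ℂ} {m : ℕ} (hA : A.totalDegree ≤ m + 1) :
    (X 0 * dx A + X 1 * dy A - C ((m + 1 : ℕ) : ℂ) * A).totalDegree ≤ m := by
  apply deg_le
  intro s hs
  rw [coeff_sub, coeff_add, coeff_euler, coeff_euler, coeff_C_mul] at hs
  have h1 : coeff s A ≠ 0 := by
    intro h; apply hs; rw [h]; ring
  have h2 := coeff_ne_deg h1 hA
  by_contra h3
  apply hs
  have h4 : m + 1 = s 0 + s 1 := by omega
  rw [h4]; push_cast; ring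

theorem deg_cmul {A B : MvPolynomial (Fin 2) ℂ} {k l d : ℕ} (z : ℂ) (hA : A.totalDegree ≤ k)
    (hB : B.totalDegree ≤ l) (h : k + l ≤ d) : (C z * A * B).totalDegree ≤ d := by
  refine (totalDegree_mul _ _).trans ?_
  have := totalDegree_mul (C z) A
  rw [totalDegree_C] at this
  omega

/-- `n B dA - m A dB` -/
def eta (i : Fin 2) (m n : ℕ) (A B : MvPolynomial (Fin 2) ℂ) : MvPolynomial (Fin 2) ℂ :=
  C (n : ℂ) * B * pderiv i A - C (m : ℂ) * A * pderiv i B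

theorem eta_deg (i : Fin 2) {m n : ℕ} {A B : MvPolynomial (Fin 2) ℂ}
    (hA : A.totalDegree ≤ m) (hB : B.totalDegree ≤ n) (hm : 1 ≤ m) (hn : 1 ≤ n) (h : m + n ≤ 6) :
    (eta i m n A B).totalDegree ≤ 5 := by
  obtain ⟨m, rfl⟩ := Nat.exists_eq_add_of_le' hm
  obtain ⟨n, rfl⟩ := Nat.exists_eq_add_of_le' hn
  refine (totalDegree_sub _ _).trans (max_le ?_ ?_)
  · exact deg_cmul _ hB (deg_pderiv i hA) (by omega)
  · exact deg_cmul _ hA (deg_pderiv i hB) (by omega)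

theorem eta_top {m n : ℕ} {A B : MvPolynomial (Fin 2) ℂ}
    (hA : A.totalDegree ≤ m) (hB : B.totalDegree ≤ n) (hm : 1 ≤ m) (hn : 1 ≤ n) (h : m + n ≤ 6)
    (i j : ℕ) (hij : i + j = 6) :
    coeff (ee i j) (X 0 * eta 0 m n A B + X 1 * eta 1 m n A B) = 0 := by
  obtain ⟨m, rfl⟩ := Nat.exists_eq_add_of_le' hm
  obtain ⟨n, rfl⟩ := Nat.exists_eq_add_of_le' hn
  have e : X 0 * eta 0 (m+1) (n+1) A B + X 1 * eta 1 (m+1) (n+1) A B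
    = C ((n + 1 : ℕ) : ℂ) * B * (X 0 * dx A + X 1 * dy A - C ((m + 1 : ℕ) : ℂ) * A)
      - C ((m + 1 : ℕ) : ℂ) * A * (X 0 * dx B + X 1 * dy B - C ((n + 1 : ℕ) : ℂ) * B) := by
    simp only [eta, dx, dy]; ring
  rw [e]
  refine coeff_deg (d := 5) ((totalDegree_sub _ _).trans (max_le ?_ ?_)) (by omega)
  · exact deg_cmul _ hB (deg_euler hA) (by omega)
  · exact deg_cmul _ hA (deg_euler hB) (by omega)

theorem deg_gi : gi.totalDegree = 6 := by
  apply le_antisymm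
  · apply deg_le
    intro s hs
    rw [ee_eta s, coeff_gi] at hs
    by_contra h
    apply hs
    by_cases h7 : s 0 < 7 ∧ s 1 < 7
    · have : ∀ i < 7, ∀ j < 7, ¬ (i + j ≤ 6) → Gc i j = 0 := by decide
      rw [this _ h7.1 _ h7.2 h]; simp
    · rw [Gc_zero h7]; simp
  · by_contra h
    have := coeff_deg (a := gi) (d := 5) (by omega) (i := 6) (j := 0) (by omega)
    rw [coeff_gi] at this
    norm_cast at this

theorem deg_g : g.totalDegree = 6 := by
  have h := deg_gi
  have h0 : g ≠ 0 := by
    intro h0; rw [gi_eq, h0] at h; simp at h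
  rw [gi_eq, totalDegree_mul_of_isDomain (by simp) h0, totalDegree_C] at h
  omega

theorem no_factor {A B : MvPolynomial (Fin 2) ℂ} (h : g = A * B)
    (hA : 1 ≤ A.totalDegree) (hB : 1 ≤ B.totalDegree) : False := by
  have hd := deg_g
  have hA0 : A ≠ 0 := by rintro rfl; simp at hA
  have hB0 : B ≠ 0 := by rintro rfl; simp at hB
  rw [h, totalDegree_mul_of_isDomain hA0 hB0] at hd
  generalize hm : A.totalDegree = m at *
  generalize hn : B.totalDegree = n at *
  have hE : EE 6 (eta 0 m n A B) (eta 1 m n A B) = 0 := by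
    apply EE_of
    have hx := dxy A
    have hy := dxy B
    have hmn : (C (m : ℂ) : MvPolynomial (Fin 2) ℂ) + C (n : ℂ) = 6 := by
      rw [← C_add, ← Nat.cast_add, hd]; exact map_ofNat C 6
    simp only [h, eta, dx, dy, map_sub, pderiv_mul, pderiv_C] at *
    rw [← hx, ← hy]
    push_cast
    ring
  obtain ⟨-, h2⟩ := lin 6 rowL6 LL6 ML6 chk1_6 chk2_6 (by decide)
    (eta_deg 0 hm.le hn.le hA hB hd.le) (eta_deg 1 hm.le hn.le hA hB hd.le) hE
    (eta_top hm.le hn.le hA hB hd.le)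
  have e0 := eval_g
  have e1 := eval_dyg
  have e2 := congrArg (eval ![1, 0]) h2
  rw [h] at e0 e1
  simp only [dy, eta, pderiv_mul, map_add, map_mul, map_sub, eval_C, map_zero] at e0 e1 e2
  have hm0 : (m : ℂ) ≠ 0 := by exact_mod_cast (by omega : m ≠ 0)
  have hn0 : (n : ℂ) ≠ 0 := by exact_mod_cast (by omega : n ≠ 0)
  rcases mul_eq_zero.1 e0 with e | e
  · rw [e] at e1 e2
    have : (n : ℂ) = 0 := by linear_combination (n : ℂ) * e1 - e2
    exact hn0 this
  · rw [e] at e1 e2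
    have : (m : ℂ) = 0 := by linear_combination (m : ℂ) * e1 + e2
    exact hm0 this

theorem no_torus {p q : MvPolynomial (Fin 2) ℂ} (hp : p.totalDegree ≤ 2) (hq : q.totalDegree ≤ 3)
    (h : g = p ^ 3 + q ^ 2) : False := by
  have hE : EE 5 (eta 0 3 2 q p) (eta 1 3 2 q p) = 0 := by
    apply EE_of
    have hx := dxy p
    have hy := dxy q
    have c2 : (C ((2 : ℕ) : ℂ) : MvPolynomial (Fin 2) ℂ) = 2 := map_ofNat C 2
    have c3 : (C ((3 : ℕ) : ℂ) : MvPolynomial (Fin 2) ℂ) = 3 := map_ofNat C 3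
    have d2 : ∀ i : Fin 2, pderiv i (2 : MvPolynomial (Fin 2) ℂ) = 0 := fun i => by
      rw [← c2, pderiv_C]
    have d3 : ∀ i : Fin 2, pderiv i (3 : MvPolynomial (Fin 2) ℂ) = 0 := fun i => by
      rw [← c3, pderiv_C]
    simp only [h, eta, dx, dy, map_sub, map_add, pderiv_mul, pderiv_pow, c2, c3, d2, d3] at *
    rw [← hx, ← hy]
    push_cast
    ring
  obtain ⟨-, h2⟩ := lin 5 rowL5 LL5 ML5 chk1_5 chk2_5 (by decide)
    (eta_deg 0 hq hp (by norm_num) (by norm_num) (by norm_num))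
    (eta_deg 1 hq hp (by norm_num) (by norm_num) (by norm_num)) hE
    (eta_top hq hp (by norm_num) (by norm_num) (by norm_num))
  have e0 := eval_g
  have e1 := eval_dyg
  have e2 := congrArg (eval ![1, 0]) h2
  rw [h] at e0 e1
  simp only [dy, eta, pderiv_mul, pderiv_pow, map_add, map_mul, map_sub, eval_C, map_zero, map_pow,
    map_natCast] at e0 e1 e2
  push_cast at e0 e1 e2
  generalize eval ![1, 0] p = P at *
  generalize eval ![1, 0] q = Q at *
  generalize eval ![1, 0] (pderiv 1 p) = P' at *
  generalize eval ![1, 0] (pderiv 1 q) = Q' at *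
  norm_num at e1
  have hQ : Q = 0 := by
    linear_combination Q * e1 - 2 * Q' * e0 + P ^ 2 * e2
  subst hQ
  have hP : P = 0 := by
    have : P ^ 3 = 0 := by linear_combination e0
    exact pow_eq_zero_iff (by norm_num) |>.1 this
  subst hP
  norm_num at e1

theorem unit_of_deg {A : MvPolynomial (Fin 2) ℂ} (h0 : A ≠ 0) (h : ¬ 1 ≤ A.totalDegree) :
    IsUnit A := by
  have h1 : A.totalDegree = 0 := by omega
  rw [totalDegree_eq_zero_iff_eq_C] at h1
  rw [h1] at h0 ⊢
  refine IsUnit.map C (isUnit_iff_ne_zero.2 ?_)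
  intro h2
  rw [h2] at h0
  simp at h0

/-- `g` is irreducible and of non-torus type. -/
theorem g_irreducible_and_non_torus :
    Irreducible g ∧
      ¬ ∃ p q : MvPolynomial (Fin 2) ℂ,
        p.totalDegree ≤ 2 ∧ q.totalDegree ≤ 3 ∧ g = p ^ 3 + q ^ 2 := by
  refine ⟨⟨?_, ?_⟩, ?_⟩
  · intro hu
    rw [isUnit_iff_totalDegree_of_isReduced, deg_g] at hu
    omega
  · intro A B h
    have hg0 : g ≠ 0 := by
      intro h0; have := deg_g; rw [h0] at this; simp at this
    rw [h] at hg0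
    by_contra hc
    push Not at hc
    refine no_factor h ?_ ?_
    · by_contra hA
      exact hc.1 (unit_of_deg (left_ne_zero_of_mul hg0) hA)
    · by_contra hB
      exact hc.2 (unit_of_deg (right_ne_zero_of_mul hg0) hB)
  · rintro ⟨p, q, hp, hq, h⟩
    exact no_torus hp hq h

end
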